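/- arXiv:2303.03380 — 8 statements merged into one kernel-verified Lean document; each statement's English description precedes it below -/
import Mathlib

section
/- Let n ≥ 1, let r, s : Fin n → ℝ satisfy 0 < r j and 0 < s j for all j, and let α ∈ (1, ∞). Then the series ∑_{k ∈ ℕ^n} ∏_{j} ((1 − exp(−r j)) · exp(−(k j) · r j))^α · ((1 − exp(−s j)) · exp(−(k j) · s j))^(1−α) converges (i.e. the family is summable) if and only if for every j with r j < s j one has α < s j / (s j − r j). (Equivalently, the series converges iff α is strictly less than the minimum of the set { s j / (s j − r j) : r j < s j }, with the convention that the minimum of the empty set is +∞.) -/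
theorem summable_prod_apply_of_nonneg {ι : Type*} {n : ℕ} {f : Fin n → ι → ℝ}
    (hf : ∀ j x, 0 ≤ f j x) (h : ∀ j, Summable (f j)) :
    Summable (fun k : Fin n → ι => ∏ j, f j (k j)) := by
  induction n with
  | zero => exact Summable.of_finite
  | succ n ih =>
    rw [← (Fin.consEquiv fun _ => ι).summable_iff]
    have key := (h 0).mul_of_nonneg (ih (fun j => hf j.succ) fun j => h j.succ) (hf 0)
      fun k => Finset.prod_nonneg fun j _ => hf j.succ (k j)
    simpa [Function.comp_def, Fin.prod_univ_succ, Fin.consEquiv] using key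

theorem summable_prod_apply_iff_of_pos {ι : Type*} [Nonempty ι] {n : ℕ} {f : Fin n → ι → ℝ}
    (hf : ∀ j x, 0 < f j x) :
    Summable (fun k : Fin n → ι => ∏ j, f j (k j)) ↔ ∀ j, Summable (f j) := by
  refine ⟨fun h j => ?_, summable_prod_apply_of_nonneg fun j x => (hf j x).le⟩
  obtain ⟨x₀⟩ := ‹Nonempty ι›
  have key := h.comp_injective (Function.update_injective (fun _ => x₀) j)
  have hne : ∏ i ∈ Finset.univ.erase j, f i x₀ ≠ 0 :=
    Finset.prod_ne_zero_iff.mpr fun i _ => (hf i x₀).ne'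
  rw [← summable_mul_right_iff hne]
  refine key.congr fun x => ?_
  rw [Function.comp_apply, ← Finset.mul_prod_erase _ _ (Finset.mem_univ j),
    Function.update_self]
  congr 1
  refine Finset.prod_congr rfl fun i hi => ?_
  rw [Function.update_of_ne (Finset.ne_of_mem_erase hi)]

theorem one_sub_exp_neg_pos {r : ℝ} (hr : 0 < r) : 0 < 1 - Real.exp (-r) := by
  simpa using hr

theorem thermal_weight_eq_geometric {r s : ℝ} (hr : 0 < r) (hs : 0 < s) (α : ℝ) (k : ℕ) :
    ((1 - Real.exp (-r)) * Real.exp (-(k : ℝ) * r)) ^ α *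
        ((1 - Real.exp (-s)) * Real.exp (-(k : ℝ) * s)) ^ (1 - α) =
      ((1 - Real.exp (-r)) ^ α * (1 - Real.exp (-s)) ^ (1 - α)) *
        Real.exp (-(α * r + (1 - α) * s)) ^ k := by
  rw [Real.mul_rpow (one_sub_exp_neg_pos hr).le (Real.exp_pos _).le,
    Real.mul_rpow (one_sub_exp_neg_pos hs).le (Real.exp_pos _).le,
    ← Real.exp_mul, ← Real.exp_mul, mul_mul_mul_comm, ← Real.exp_add, ← Real.exp_nat_mul]
  ring_nf

theorem summable_thermal_weight_iff {r s α : ℝ} (hr : 0 < r) (hs : 0 < s) (hα : 0 ≤ α) :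
    Summable (fun k : ℕ => ((1 - Real.exp (-r)) * Real.exp (-(k : ℝ) * r)) ^ α *
        ((1 - Real.exp (-s)) * Real.exp (-(k : ℝ) * s)) ^ (1 - α)) ↔
      (r < s → α < s / (s - r)) := by
  have hne : (1 - Real.exp (-r)) ^ α * (1 - Real.exp (-s)) ^ (1 - α) ≠ 0 :=
    (mul_pos (Real.rpow_pos_of_pos (one_sub_exp_neg_pos hr) _)
      (Real.rpow_pos_of_pos (one_sub_exp_neg_pos hs) _)).ne'
  simp_rw [thermal_weight_eq_geometric hr hs]
  rw [summable_mul_left_iff hne, summable_geometric_iff_norm_lt_one, Real.norm_eq_abs,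
    Real.abs_exp, Real.exp_lt_one_iff, neg_lt_zero]
  refine ⟨fun h hrs => ?_, fun h => ?_⟩
  · rw [lt_div_iff₀ (sub_pos.mpr hrs)]
    linarith
  · rcases lt_or_ge r s with hrs | hrs
    · have := (lt_div_iff₀ (sub_pos.mpr hrs)).mp (h hrs)
      linarith
    · nlinarith [mul_nonneg hα (sub_nonneg.mpr hrs)]

theorem thermal_entropy_finiteness_faithful
    (n : ℕ) (hn : 1 ≤ n) (r s : Fin n → ℝ)
    (hr : ∀ j, 0 < r j) (hs : ∀ j, 0 < s j)
    (α : ℝ) (hα : 1 < α) :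
    Summable (fun k : Fin n → ℕ =>
      ∏ j, ((1 - Real.exp (-(r j))) * Real.exp (-(k j : ℝ) * r j)) ^ α *
        ((1 - Real.exp (-(s j))) * Real.exp (-(k j : ℝ) * s j)) ^ (1 - α)) ↔
    ∀ j, r j < s j → α < s j / (s j - r j) := by
  rw [summable_prod_apply_iff_of_pos (f := fun j (m : ℕ) =>
    ((1 - Real.exp (-(r j))) * Real.exp (-(m : ℝ) * r j)) ^ α *
      ((1 - Real.exp (-(s j))) * Real.exp (-(m : ℝ) * s j)) ^ (1 - α))]
  · exact forall_congr' fun j => summable_thermal_weight_iff (hr j) (hs j) (by linarith)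
  · intro j m
    have := one_sub_exp_neg_pos (hr j)
    have := one_sub_exp_neg_pos (hs j)
    positivity
end

section
/- Let n ≥ 1, let r, s : Fin n → ℝ satisfy 0 < r j and 0 < s j for all j, and suppose r j ≥ s j for every j. Then for every α > 0 the series ∑_{k ∈ ℕ^n} ∏_{j} ((1 − exp(−r j)) · exp(−(k j) · r j))^α · ((1 − exp(−s j)) · exp(−(k j) · s j))^(1−α) converges (the family is summable). -/
theorem summable_fin_prod_of_nonneg {n : ℕ} {ι : Type*} {f : Fin n → ι → ℝ}
    (hf₀ : ∀ j i, 0 ≤ f j i) (hf : ∀ j, Summable (f j)) :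
    Summable fun k : Fin n → ι => ∏ j, f j (k j) := by
  induction n with
  | zero => exact Summable.of_finite
  | succ n ih =>
    rw [← (Fin.consEquiv fun _ : Fin (n + 1) => ι).summable_iff]
    have h := (hf 0).mul_of_nonneg (ih (fun j => hf₀ j.succ) fun j => hf j.succ) (hf₀ 0)
      fun k => Finset.prod_nonneg fun j _ => hf₀ j.succ (k j)
    refine h.congr fun x => ?_
    simp [Fin.consEquiv, Fin.prod_univ_succ]

theorem summable_rpow_mul_rpow_geometric {a b r s α : ℝ} (ha : 0 ≤ a) (hb : 0 ≤ b)
    (h : 0 < r * α + s * (1 - α)) :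
    Summable fun k : ℕ =>
      (a * Real.exp (-(k : ℝ) * r)) ^ α * (b * Real.exp (-(k : ℝ) * s)) ^ (1 - α) := by
  have hgeom : Summable fun k : ℕ => Real.exp (k * -(r * α + s * (1 - α))) :=
    Real.summable_exp_nat_mul_iff.mpr (neg_neg_of_pos h)
  refine (hgeom.mul_left (a ^ α * b ^ (1 - α))).congr fun k => ?_
  rw [Real.mul_rpow ha (Real.exp_nonneg _), Real.mul_rpow hb (Real.exp_nonneg _),
    ← Real.exp_mul, ← Real.exp_mul, mul_mul_mul_comm, ← Real.exp_add]
  ring_nf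

theorem thermal_entropy_finite_all_alpha_of_ge
    (n : ℕ) (hn : 1 ≤ n) (r s : Fin n → ℝ)
    (hr : ∀ j, 0 < r j) (hs : ∀ j, 0 < s j)
    (hrs : ∀ j, s j ≤ r j)
    (α : ℝ) (hα : 0 < α) :
    Summable (fun k : Fin n → ℕ =>
      ∏ j, ((1 - Real.exp (-(r j))) * Real.exp (-(k j : ℝ) * r j)) ^ α *
        ((1 - Real.exp (-(s j))) * Real.exp (-(k j : ℝ) * s j)) ^ (1 - α)) := by
  have one_sub_exp_nonneg {t : ℝ} (ht : 0 < t) : 0 ≤ 1 - Real.exp (-t) :=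
    sub_nonneg.mpr (Real.exp_le_one_iff.mpr (neg_nonpos.mpr ht.le))
  refine summable_fin_prod_of_nonneg
    (f := fun j (k : ℕ) => ((1 - Real.exp (-(r j))) * Real.exp (-(k : ℝ) * r j)) ^ α *
      ((1 - Real.exp (-(s j))) * Real.exp (-(k : ℝ) * s j)) ^ (1 - α))
    (fun j k => ?_) fun j => ?_
  · have h₁ := one_sub_exp_nonneg (hr j)
    have h₂ := one_sub_exp_nonneg (hs j)
    positivity
  · refine summable_rpow_mul_rpow_geometric (one_sub_exp_nonneg (hr j))
      (one_sub_exp_nonneg (hs j)) ?_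
    nlinarith [mul_nonneg hα.le (sub_nonneg.mpr (hrs j)), hs j]
end

section
/- Let n ≥ 1 and let t, w : Fin n → ℝ satisfy 0 ≤ t j < 1 and 0 ≤ w j < 1 for all j, together with the support condition: for every j, w j = 0 implies t j = 0 (so in particular t j > 0 implies w j > 0). Fix α with α > 0 and α ≠ 1, and consider the series S(α) = ∑ over all k ∈ ℕ^n satisfying (t j = 0 → k j = 0 for every j) of ∏_{j} ((1 − t j) · (t j)^{k j})^α · ((1 − w j) · (w j)^{k j})^{1−α}, where for indices j with t j = 0 the corresponding factor is interpreted as (1 − w j)^{1−α} (i.e. (t j)^0 = (w j)^0 = 1). Then S(α) converges (the family is summable) if and only if for every j with 0 < w j < t j one has α · log(t j / w j) < log(1 / w j). -/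
open Finset in
/-- A multiple geometric series with nonnegative ratios, all less than one, is summable. -/
lemma summable_prod_pow_of_lt_one {ι : Type*} [Fintype ι] {q : ι → ℝ}
    (h0 : ∀ j, 0 ≤ q j) (h1 : ∀ j, q j < 1) :
    Summable (fun k : ι → ℕ => ∏ j, q j ^ k j) := by
  classical
  refine summable_of_sum_le (c := ∏ j, ∑' m, q j ^ m)
    (fun k => prod_nonneg fun j _ => pow_nonneg (h0 j) _) fun u => ?_
  calc ∑ k ∈ u, ∏ j, q j ^ k j
      ≤ ∑ k ∈ Fintype.piFinset (fun j => u.image fun k => k j), ∏ j, q j ^ k j := by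
        refine sum_le_sum_of_subset_of_nonneg (fun k hk => ?_)
          fun k _ _ => prod_nonneg fun j _ => pow_nonneg (h0 j) _
        exact Fintype.mem_piFinset.2 fun j => mem_image_of_mem _ hk
    _ = ∏ j, ∑ m ∈ u.image (fun k => k j), q j ^ m := by
        rw [prod_univ_sum]
    _ ≤ ∏ j, ∑' m, q j ^ m := by
        refine prod_le_prod (fun j _ => sum_nonneg fun m _ => pow_nonneg (h0 j) _) fun j _ => ?_
        exact (summable_geometric_of_lt_one (h0 j) (h1 j)).sum_le_tsum _
          fun m _ => pow_nonneg (h0 j) _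

/-- A multiple geometric series with nonnegative ratios is summable iff all ratios are less
than one. -/
lemma summable_prod_pow_iff {ι : Type*} [Fintype ι] {q : ι → ℝ} (h0 : ∀ j, 0 ≤ q j) :
    Summable (fun k : ι → ℕ => ∏ j, q j ^ k j) ↔ ∀ j, q j < 1 := by
  classical
  refine ⟨fun h j => ?_, summable_prod_pow_of_lt_one h0⟩
  have h2 := h.comp_injective (Pi.single_injective (M := fun _ : ι => ℕ) j)
  have h3 : Summable fun m : ℕ => q j ^ m := by
    refine h2.congr fun m => ?_
    simp only [Function.comp]
    rw [Finset.prod_eq_single j (fun i _ hi => by simp [Pi.single_eq_of_ne hi]) (by simp)]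
    simp
  have h4 := summable_geometric_iff_norm_lt_one.1 h3
  rwa [Real.norm_of_nonneg (h0 j)] at h4

lemma rpow_mul_rpow_one_sub_lt_one_iff {t w α : ℝ} (ht0 : 0 ≤ t) (ht1 : t < 1) (hw0 : 0 ≤ w)
    (hw1 : w < 1) (hsupp : w = 0 → t = 0) (hα : 0 < α) :
    t ^ α * w ^ (1 - α) < 1 ↔
      (0 < w → w < t → α * Real.log (t / w) < Real.log (1 / w)) := by
  rcases ht0.eq_or_lt with rfl | ht
  · simp only [Real.zero_rpow hα.ne', zero_mul, zero_lt_one, true_iff]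
    intro h1 h2
    linarith
  have hw : 0 < w := hw0.lt_of_ne fun h => ht.ne' (hsupp h.symm)
  have hlt := Real.log_neg ht ht1
  have hlw := Real.log_neg hw hw1
  rw [← Real.log_neg_iff (by positivity), Real.log_mul (by positivity) (by positivity),
    Real.log_rpow ht, Real.log_rpow hw, Real.log_div ht.ne' hw.ne', one_div, Real.log_inv]
  refine ⟨fun h _ _ => by linarith, fun h => ?_⟩
  rcases lt_or_ge w t with hwt | hwt
  · linarith [h hw hwt]
  · nlinarith [Real.log_le_log ht hwt]

theorem thermal_entropy_finiteness_general
    (n : ℕ) (hn : 1 ≤ n) (t w : Fin n → ℝ)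
    (ht : ∀ j, 0 ≤ t j ∧ t j < 1) (hw : ∀ j, 0 ≤ w j ∧ w j < 1)
    (hsupp : ∀ j, w j = 0 → t j = 0)
    (α : ℝ) (hα : 0 < α) (hα1 : α ≠ 1) :
    Summable (fun k : {k : Fin n → ℕ // ∀ j, t j = 0 → k j = 0} =>
      ∏ j, ((1 - t j) * t j ^ (k.1 j)) ^ α *
        ((1 - w j) * w j ^ (k.1 j)) ^ (1 - α)) ↔
    ∀ j, 0 < w j → w j < t j → α * Real.log (t j / w j) < Real.log (1 / w j) := by
  set q : Fin n → ℝ := fun j => t j ^ α * w j ^ (1 - α) with hq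
  have hq0 : ∀ j, 0 ≤ q j := fun j =>
    mul_nonneg (Real.rpow_nonneg (ht j).1 _) (Real.rpow_nonneg (hw j).1 _)
  set c : ℝ := ∏ j, ((1 - t j) ^ α * (1 - w j) ^ (1 - α)) with hc
  have hc0 : c ≠ 0 := Finset.prod_ne_zero_iff.2 fun j _ =>
    (mul_pos (Real.rpow_pos_of_pos (sub_pos.2 (ht j).2) _)
      (Real.rpow_pos_of_pos (sub_pos.2 (hw j).2) _)).ne'
  have hterm : ∀ k : {k : Fin n → ℕ // ∀ j, t j = 0 → k j = 0},
      ∏ j, ((1 - t j) * t j ^ (k.1 j)) ^ α * ((1 - w j) * w j ^ (k.1 j)) ^ (1 - α) =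
        c * ∏ j, q j ^ k.1 j := by
    intro k
    rw [hc, ← Finset.prod_mul_distrib]
    refine Finset.prod_congr rfl fun j _ => ?_
    rw [Real.mul_rpow (sub_nonneg.2 (ht j).2.le) (pow_nonneg (ht j).1 _),
      Real.mul_rpow (sub_nonneg.2 (hw j).2.le) (pow_nonneg (hw j).1 _),
      ← Real.rpow_pow_comm (ht j).1, ← Real.rpow_pow_comm (hw j).1, hq, mul_pow]
    ring
  have hsupport : Function.support (fun k : Fin n → ℕ => ∏ j, q j ^ k j) ⊆
      {k | ∀ j, t j = 0 → k j = 0} := by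
    intro k hk j hj
    by_contra hkj
    refine hk (Finset.prod_eq_zero (Finset.mem_univ j) ?_)
    simp [hq, hj, Real.zero_rpow hα.ne', hkj]
  simp_rw [hterm]
  rw [summable_mul_left_iff hc0]
  refine (exists_congr fun _ => hasSum_subtype_iff_of_support_subset hsupport).trans ?_
  change Summable _ ↔ _
  rw [summable_prod_pow_iff hq0]
  exact forall_congr' fun j => rpow_mul_rpow_one_sub_lt_one_iff (ht j).1 (ht j).2 (hw j).1
    (hw j).2 (hsupp j) hα
end

section
/- Let n ≥ 1, let r, s : Fin n → ℝ satisfy 0 < r j < ∞ and 0 < s j < ∞ for all j, and let α > 1. Define coth x = cosh x / sinh x, and let V, W be the real diagonal matrices of size 2n × 2n (indexed by Fin n × Fin 2) whose diagonal entries are V (j, i) = (1/2) · coth((α − 1) · s j / 2) and W (j, i) = (1/2) · coth(α · r j / 2) for i ∈ Fin 2. Then the matrix V − W is positive definite if and only if for every j with r j < s j one has α < s j / (s j − r j) (equivalently, α is strictly less than the minimum of { s j / (s j − r j) : r j < s j }, with the convention that the minimum of the empty set is +∞). -/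
noncomputable def coth (x : ℝ) : ℝ := Real.cosh x / Real.sinh x

theorem coth_lt_coth_iff {x y : ℝ} (hx : 0 < x) (hy : 0 < y) : coth y < coth x ↔ x < y := by
  unfold coth
  rw [div_lt_div_iff₀ (Real.sinh_pos_iff.2 hy) (Real.sinh_pos_iff.2 hx), ← sub_pos (a := y),
    ← Real.sinh_pos_iff, Real.sinh_sub, sub_pos, mul_comm (Real.sinh y), mul_comm (Real.cosh y)]

theorem covariance_posdef_iff_alpha_lt
    (n : ℕ) (hn : 1 ≤ n) (r s : Fin n → ℝ)
    (hr : ∀ j, 0 < r j) (hs : ∀ j, 0 < s j)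
    (α : ℝ) (hα : 1 < α)
    (V W : Matrix (Fin n × Fin 2) (Fin n × Fin 2) ℝ)
    (hV : V = Matrix.diagonal (fun p => (1 / 2) * coth ((α - 1) * s p.1 / 2)))
    (hW : W = Matrix.diagonal (fun p => (1 / 2) * coth (α * r p.1 / 2))) :
    (V - W).PosDef ↔ ∀ j, r j < s j → α < s j / (s j - r j) := by
  subst hV hW
  rw [Matrix.diagonal_sub, Matrix.posDef_diagonal_iff]
  have key (j : Fin n) :
      0 < 1 / 2 * coth ((α - 1) * s j / 2) - 1 / 2 * coth (α * r j / 2) ↔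
        (r j < s j → α < s j / (s j - r j)) := by
    have hsj : 0 < (α - 1) * s j / 2 := half_pos (mul_pos (sub_pos.2 hα) (hs j))
    have hrj : 0 < α * r j / 2 := half_pos (mul_pos (zero_lt_one.trans hα) (hr j))
    rw [sub_pos, mul_lt_mul_iff_right₀ one_half_pos, coth_lt_coth_iff hsj hrj]
    rcases lt_or_ge (r j) (s j) with h | h
    · rw [lt_div_iff₀ (sub_pos.2 h)]
      simp only [h, forall_const]
      constructor <;> intro _ <;> linarith
    · simp only [h.not_gt, false_imp_iff, iff_true]
      nlinarith [hs j]
  exact ⟨fun h j => (key j).1 (h (j, 0)), fun h p => (key p.1).2 (h p.1)⟩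
end

section
/- For every real number c > 0, the set of positive integers j such that |sin(2 · √j · c + π/4)| ≥ 1/√2 is infinite. -/
theorem one_div_sqrt_two_le_abs_sin_add_pi_div_four {x : ℝ} (hx : 0 ≤ Real.sin (2 * x)) :
    1 / Real.sqrt 2 ≤ |Real.sin (x + Real.pi / 4)| := by
  refine le_trans (le_abs_self _) (sq_le_sq.mp ?_)
  have h : Real.sin (x + Real.pi / 4) ^ 2 = (1 + Real.sin (2 * x)) / 2 := by
    rw [Real.sin_sq_eq_half_sub, mul_add, show 2 * (Real.pi / 4) = Real.pi / 2 by ring,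
      Real.cos_add_pi_div_two]
    ring
  have h2 : (1 / Real.sqrt 2) ^ 2 = 1 / 2 := by
    rw [div_pow, one_pow, Real.sq_sqrt zero_le_two]
  rw [h, h2]
  linarith

theorem sin_lower_bound_infinitely_often (c : ℝ) (hc : 0 < c) :
    {j : ℕ | 0 < j ∧
      1 / Real.sqrt 2 ≤ |Real.sin (2 * Real.sqrt j * c + Real.pi / 4)|}.Infinite := by
  refine Set.infinite_of_forall_exists_gt fun N => ?_
  obtain ⟨d, hd⟩ : ∃ d, d = Real.pi / (4 * c) := ⟨_, rfl⟩
  have hd0 : 0 < d := hd ▸ by positivity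
  have hcd : 4 * c * d = Real.pi := by rw [hd]; field_simp
  obtain ⟨n, hn⟩ := exists_nat_ge ((N + 1 + 1 / (2 * d)) / (2 * d))
  rw [div_le_iff₀ (by positivity)] at hn
  obtain ⟨a, ha⟩ : ∃ a, a = (n : ℝ) * (2 * d) := ⟨_, rfl⟩
  rw [← ha] at hn
  have hd1 : 0 < 1 / (2 * d) := by positivity
  have haN : (N : ℝ) + 1 ≤ a := by linarith
  have had : 1 ≤ a * (2 * d) := by
    rw [← div_le_iff₀ (by positivity)]
    linarith [(Nat.cast_nonneg N : (0 : ℝ) ≤ N)]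
  have hN : (0 : ℝ) ≤ N := Nat.cast_nonneg N
  have hle : a ^ 2 ≤ (⌈a ^ 2⌉₊ : ℝ) := Nat.le_ceil _
  have hlt : (⌈a ^ 2⌉₊ : ℝ) < a ^ 2 + 1 := Nat.ceil_lt_add_one (sq_nonneg a)
  have hgt : N < ⌈a ^ 2⌉₊ := by
    rw [Nat.lt_ceil]
    nlinarith
  refine ⟨⌈a ^ 2⌉₊, ⟨by omega, ?_⟩, hgt⟩
  apply one_div_sqrt_two_le_abs_sin_add_pi_div_four
  have hl : a ≤ Real.sqrt ⌈a ^ 2⌉₊ := Real.le_sqrt_of_sq_le hle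
  have hu : Real.sqrt ⌈a ^ 2⌉₊ ≤ a + d :=
    Real.sqrt_le_iff.mpr ⟨by linarith, by nlinarith⟩
  have hca : 4 * c * a = n * (2 * Real.pi) := by rw [ha, ← hcd]; ring
  rw [← Real.sin_sub_nat_mul_two_pi _ n, ← hca]
  apply Real.sin_nonneg_of_nonneg_of_le_pi
  · nlinarith
  · nlinarith
end

section
/- Let L_j denote the j-th Laguerre polynomial, L_j(x) = ∑_{k=0}^{j} (j choose k) · (−1)^k / k! · x^k. Then for every real x > 0 there exists a constant C > 0 such that |L_j(x)| ≥ C / j^{3/8} for infinitely many positive integers j. -/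
noncomputable def laguerre (j : ℕ) (x : ℝ) : ℝ :=
  ∑ k ∈ Finset.range (j + 1), (j.choose k : ℝ) * (-1) ^ k / (k.factorial : ℝ) * x ^ k

/-- The weighted difference of consecutive Laguerre polynomials, in closed form. -/
noncomputable def laguerreDiff (n : ℕ) (x : ℝ) : ℝ :=
  ∑ k ∈ Finset.range n, (n.choose (k + 1) : ℝ) * (-1) ^ (k + 1) / (k.factorial : ℝ) * x ^ (k + 1)

/-- The Christoffel–Darboux kernel on the diagonal. -/
noncomputable def laguerreKernel (n : ℕ) (x : ℝ) : ℝ :=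
  ∑ k ∈ Finset.range n, laguerre k x ^ 2

theorem laguerreKernel_succ (n : ℕ) (x : ℝ) :
    laguerreKernel (n + 1) x = laguerreKernel n x + laguerre n x ^ 2 :=
  Finset.sum_range_succ _ _

theorem laguerre_zero (x : ℝ) : laguerre 0 x = 1 := by
  simp [laguerre]

theorem laguerreDiff_succ (n : ℕ) (x : ℝ) :
    laguerreDiff (n + 1) x = laguerreDiff n x - x * laguerre n x := by
  have h : laguerreDiff n x = ∑ k ∈ Finset.range (n + 1),
      (n.choose (k + 1) : ℝ) * (-1) ^ (k + 1) / (k.factorial : ℝ) * x ^ (k + 1) := by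
    rw [Finset.sum_range_succ, laguerreDiff]
    simp
  rw [h, laguerreDiff, laguerre, Finset.mul_sum, ← Finset.sum_sub_distrib]
  refine Finset.sum_congr rfl fun k _ => ?_
  rw [Nat.choose_succ_succ]
  push_cast
  ring

theorem laguerre_succ (n : ℕ) (x : ℝ) :
    laguerre (n + 1) x = laguerre n x + laguerreDiff (n + 1) x / (n + 1) := by
  have h : laguerre n x = ∑ k ∈ Finset.range (n + 1 + 1),
      (n.choose k : ℝ) * (-1) ^ k / (k.factorial : ℝ) * x ^ k := by
    rw [Finset.sum_range_succ, laguerre]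
    simp
  rw [h, laguerre, laguerreDiff, Finset.sum_div, Finset.sum_range_succ',
    Finset.sum_range_succ' _ (n + 1), add_right_comm, ← Finset.sum_add_distrib]
  congr 1
  · refine Finset.sum_congr rfl fun k _ => ?_
    have hc : ((n : ℝ) + 1) * n.choose k = (n + 1).choose (k + 1) * (k + 1) := by
      exact_mod_cast Nat.add_one_mul_choose_eq n k
    have hp : ((n + 1).choose (k + 1) : ℝ) = n.choose k + n.choose (k + 1) := by
      exact_mod_cast Nat.choose_succ_succ n k
    have hf : (k.factorial : ℝ) ≠ 0 := by positivity
    have hd : ((n + 1).choose (k + 1) : ℝ) / (k.factorial : ℝ) / (n + 1)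
        = n.choose k / ((k + 1).factorial : ℝ) := by
      rw [Nat.factorial_succ]
      push_cast
      field_simp
      linear_combination -hc
    calc _ = ((n.choose (k + 1) : ℝ) / ((k + 1).factorial : ℝ)
          + n.choose k / ((k + 1).factorial : ℝ)) * ((-1) ^ (k + 1) * x ^ (k + 1)) := by
          rw [hp]; ring
      _ = _ := by rw [← hd]; ring
  · simp

/-- The Christoffel–Darboux formula on the diagonal. -/
theorem laguerreKernel_eq (n : ℕ) (x : ℝ) :
    x * laguerreKernel n x = laguerreDiff n x ^ 2 - x * (laguerre n x * laguerreDiff n x)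
      + x * n * laguerre n x ^ 2 := by
  induction n with
  | zero => simp [laguerreKernel, laguerreDiff]
  | succ n ih =>
    rw [laguerreKernel_succ, mul_add, ih, laguerre_succ, laguerreDiff_succ]
    push_cast
    field_simp
    ring

theorem laguerre_mul_diff_succ (n : ℕ) (x : ℝ) :
    laguerre (n + 1) x * laguerreDiff (n + 1) x = laguerre n x * laguerreDiff n x
      + laguerreDiff (n + 1) x ^ 2 / (n + 1) - x * laguerre n x ^ 2 := by
  rw [laguerre_succ, laguerreDiff_succ]
  ring

theorem one_le_laguerreKernel {n : ℕ} (hn : 0 < n) (x : ℝ) : 1 ≤ laguerreKernel n x := by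
  calc (1 : ℝ) = laguerre 0 x ^ 2 := by simp [laguerre_zero]
    _ ≤ laguerreKernel n x :=
      Finset.single_le_sum (f := fun k => laguerre k x ^ 2) (fun _ _ => sq_nonneg _)
        (Finset.mem_range.2 hn)

theorem mul_laguerre_sq_add_diff_sq_le {n : ℕ} {x : ℝ} (hx : 0 < x) (hn : x ≤ n) :
    x * n * laguerre n x ^ 2 + laguerreDiff n x ^ 2 ≤ 2 * x * laguerreKernel n x := by
  have h := laguerreKernel_eq n x
  have h1 : x * x * laguerre n x ^ 2 ≤ x * n * laguerre n x ^ 2 := by gcongr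
  nlinarith [sq_nonneg (x * laguerre n x - laguerreDiff n x)]

theorem eventually_laguerre_sq_le {x ε : ℝ} (hx : 0 < x) (hε : 0 < ε) :
    ∀ᶠ n : ℕ in Filter.atTop, laguerre n x ^ 2 ≤ ε * laguerreKernel n x ∧
      |laguerre n x * laguerreDiff n x| ≤ ε * laguerreKernel n x := by
  have ht := tendsto_natCast_atTop_atTop (R := ℝ)
  filter_upwards [ht.eventually_ge_atTop x, ht.eventually_ge_atTop (2 / ε),
    ht.eventually_ge_atTop (4 * x / ε ^ 2), Filter.eventually_gt_atTop 0] with n h1 h2 h3 h0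
  have hS := one_le_laguerreKernel h0 x
  have hb := mul_laguerre_sq_add_diff_sq_le hx h1
  have hn : (0 : ℝ) < n := by exact_mod_cast h0
  rw [div_le_iff₀ (by positivity)] at h2 h3
  have hL : n * laguerre n x ^ 2 ≤ 2 * laguerreKernel n x := by
    refine le_of_mul_le_mul_left ?_ hx
    nlinarith [sq_nonneg (laguerreDiff n x)]
  have hD : laguerreDiff n x ^ 2 ≤ 2 * x * laguerreKernel n x := by
    have : 0 ≤ x * n * laguerre n x ^ 2 := by positivity
    linarith
  constructor
  · refine le_of_mul_le_mul_left (hL.trans ?_) hn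
    nlinarith
  · refine abs_le_of_sq_le_sq ?_ (by positivity)
    refine le_of_mul_le_mul_left ?_ hn
    calc (n : ℝ) * (laguerre n x * laguerreDiff n x) ^ 2
        = (n * laguerre n x ^ 2) * laguerreDiff n x ^ 2 := by ring
      _ ≤ (2 * laguerreKernel n x) * (2 * x * laguerreKernel n x) := by gcongr
      _ = 4 * x * laguerreKernel n x ^ 2 := by ring
      _ ≤ (n * ε ^ 2) * laguerreKernel n x ^ 2 := by gcongr
      _ = _ := by ring

theorem exists_rpow_le_of_growth {W : ℕ → ℝ} {a : ℝ} (ha : 0 < a) (ha' : a ≤ 1) {N : ℕ}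
    (hpos : ∀ n ≥ N, 0 < W n)
    (h : ∀ n ≥ N, a * W (n + 1) / (n + 1) ≤ W (n + 1) - W n) :
    ∃ c > 0, ∀ n ≥ N, c * (n + 1 : ℝ) ^ a ≤ W n := by
  refine ⟨W N / (N + 1 : ℝ) ^ a, div_pos (hpos N le_rfl) (by positivity), fun n hn => ?_⟩
  induction n, hn using Nat.le_induction with
  | base => rw [div_mul_cancel₀ _ (by positivity)]
  | succ n hn ih =>
    set c := W N / (N + 1 : ℝ) ^ a
    have hW := hpos n hn
    have hn1 : (0 : ℝ) < n + 1 := by positivity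
    have hstep : W n * (1 + a / (n + 1)) ≤ W (n + 1) := by
      have h1 := h n hn
      have h2 := hpos (n + 1) (by omega)
      have h3 : W n ≤ W (n + 1) := by
        have : 0 ≤ a * W (n + 1) / (n + 1) := by positivity
        linarith
      have h4 : a * W n / (n + 1) ≤ a * W (n + 1) / (n + 1) := by gcongr
      calc W n * (1 + a / (n + 1)) = W n + a * W n / (n + 1) := by ring
        _ ≤ _ := by linarith
    have hb : (1 + 1 / (n + 1 : ℝ)) ^ a ≤ 1 + a / (n + 1) := by
      refine (rpow_one_add_le_one_add_mul_self ?_ ha.le ha').trans_eq (by ring)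
      have : 0 ≤ 1 / (n + 1 : ℝ) := by positivity
      linarith
    calc c * ((n + 1 : ℕ) + 1 : ℝ) ^ a
        = c * ((n + 1 : ℝ) ^ a * (1 + 1 / (n + 1 : ℝ)) ^ a) := by
          rw [← Real.mul_rpow (by positivity) (by positivity)]
          congr 2
          push_cast
          field_simp
      _ = c * (n + 1 : ℝ) ^ a * (1 + 1 / (n + 1 : ℝ)) ^ a := by ring
      _ ≤ W n * (1 + a / (n + 1)) := by gcongr
      _ ≤ _ := hstep

theorem exists_rpow_le_laguerreKernel {x : ℝ} (hx : 0 < x) :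
    ∃ c > 0, ∀ᶠ n : ℕ in Filter.atTop, c * (n : ℝ) ^ (3 / 8 : ℝ) ≤ laguerreKernel n x := by
  have hε : 0 < x / (4 * (1 + 2 * x)) := by positivity
  set ε := x / (4 * (1 + 2 * x)) with hεdef
  have hεx : ε * (4 * (1 + 2 * x)) = x := by rw [hεdef]; field_simp
  obtain ⟨N, hN⟩ := Filter.eventually_atTop.1
    ((eventually_laguerre_sq_le hx hε).and (Filter.eventually_gt_atTop 0))
  set W : ℕ → ℝ := fun n => laguerre n x * laguerreDiff n x + 2 * x * laguerreKernel n x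
    + x * laguerre n x ^ 2 with hW
  have hdiff : ∀ n : ℕ, W (n + 1) - W n = x * (laguerreKernel (n + 1) x
      + laguerre (n + 1) x * laguerreDiff (n + 1) x) / (n + 1) := by
    intro n
    have h1 := laguerre_mul_diff_succ n x
    have h2 := laguerreKernel_eq (n + 1) x
    have h3 := laguerreKernel_succ n x
    have h4 : laguerreDiff (n + 1) x ^ 2 / (n + 1) = x * (laguerreKernel (n + 1) x
      + laguerre (n + 1) x * laguerreDiff (n + 1) x) / (n + 1) - x * laguerre (n + 1) x ^ 2 := by
      push_cast at h2
      field_simp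
      linear_combination -h2
    simp only [hW]
    linear_combination h1 + h4 + 2 * x * h3
  obtain ⟨c, hc, h⟩ := exists_rpow_le_of_growth (W := W) (a := 3 / 8) (N := N) (by norm_num)
    (by norm_num) (fun n hn => by
      obtain ⟨⟨-, h2⟩, h0⟩ := hN n hn
      have hS := one_le_laguerreKernel h0 x
      have := (abs_le.1 h2).1
      have : 0 ≤ x * laguerre n x ^ 2 := by positivity
      have : ε * (4 * (1 + 2 * x)) * laguerreKernel n x = x * laguerreKernel n x := by rw [hεx]
      have : 0 < x * laguerreKernel n x := by positivity
      have : 0 ≤ ε * laguerreKernel n x := by positivity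
      have : 0 ≤ x * (ε * laguerreKernel n x) := by positivity
      simp only [hW]
      linarith) (fun n hn => by
      rw [hdiff]
      refine div_le_div_of_nonneg_right ?_ (by positivity)
      obtain ⟨⟨h1, h2⟩, h0⟩ := hN (n + 1) (by omega)
      have hS := one_le_laguerreKernel h0 x
      have h3 := abs_le.1 h2
      have h4 := mul_le_mul_of_nonneg_left h1 hx.le
      have h5 := mul_le_mul_of_nonneg_left h3.1 hx.le
      have h6 : ε * (4 * (1 + 2 * x)) * laguerreKernel (n + 1) x
        = x * laguerreKernel (n + 1) x := by rw [hεx]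
      have h7 : 0 ≤ ε * laguerreKernel (n + 1) x := by positivity
      have h8 : 0 ≤ x * (ε * laguerreKernel (n + 1) x) := by positivity
      simp only [hW]
      linarith)
  refine ⟨c / (4 * x), by positivity, Filter.eventually_atTop.2 ⟨N, fun n hn => ?_⟩⟩
  obtain ⟨⟨h1, h2⟩, h0⟩ := hN n hn
  have hS := one_le_laguerreKernel h0 x
  have h3 := abs_le.1 h2
  have h4 := mul_le_mul_of_nonneg_left h1 hx.le
  have h6 : ε * (4 * (1 + 2 * x)) * laguerreKernel n x = x * laguerreKernel n x := by rw [hεx]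
  have h7 : 0 ≤ ε * laguerreKernel n x := by positivity
  have h8 : 0 ≤ x * (ε * laguerreKernel n x) := by positivity
  have h9 : 0 ≤ x * laguerreKernel n x := by positivity
  have h10 : (n : ℝ) ^ (3 / 8 : ℝ) ≤ (n + 1 : ℝ) ^ (3 / 8 : ℝ) := by gcongr; linarith
  have h11 : c * (n + 1 : ℝ) ^ (3 / 8 : ℝ) ≤ 4 * x * laguerreKernel n x := by
    refine (h n hn).trans ?_
    simp only [hW]
    linarith
  rw [div_mul_eq_mul_div, div_le_iff₀ (by positivity)]
  nlinarith [mul_le_mul_of_nonneg_left h10 hc.le]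

theorem rpow_neg_le_sub_rpow {n : ℕ} (hn : 0 < n) :
    (n : ℝ) ^ (-(3 / 4) : ℝ) ≤ 4 * ((n : ℝ) ^ (1 / 4 : ℝ) - ((n : ℝ) - 1) ^ (1 / 4 : ℝ)) := by
  have hn0 : (0 : ℝ) < n := by exact_mod_cast hn
  have hn1 : (1 : ℝ) ≤ n := by exact_mod_cast hn
  have hinv : 1 / (n : ℝ) ≤ 1 := by rw [div_le_one hn0]; exact hn1
  have hb : (1 + -(1 / (n : ℝ))) ^ (1 / 4 : ℝ) ≤ 1 + 1 / 4 * -(1 / (n : ℝ)) :=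
    rpow_one_add_le_one_add_mul_self (by linarith) (by norm_num) (by norm_num)
  have hs : ((n : ℝ) - 1) ^ (1 / 4 : ℝ)
      = (n : ℝ) ^ (1 / 4 : ℝ) * (1 + -(1 / (n : ℝ))) ^ (1 / 4 : ℝ) := by
    rw [← Real.mul_rpow hn0.le (by linarith)]
    congr 1
    field_simp
    ring
  have hp : (n : ℝ) ^ (-(3 / 4) : ℝ) = (n : ℝ) ^ (1 / 4 : ℝ) * (1 / n) := by
    rw [show (-(3 / 4) : ℝ) = 1 / 4 - 1 by norm_num, Real.rpow_sub_one hn0.ne']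
    ring
  rw [hs, hp]
  nlinarith [mul_le_mul_of_nonneg_left hb (Real.rpow_nonneg hn0.le (1 / 4))]

theorem laguerre_abs_lower_bound (x : ℝ) (hx : 0 < x) :
    ∃ C > 0, {j : ℕ | 0 < j ∧ C / (j : ℝ) ^ ((3 : ℝ) / 8) ≤ |laguerre j x|}.Infinite := by
  refine ⟨1, one_pos, fun hfin => ?_⟩
  obtain ⟨N, hN⟩ : ∃ N : ℕ, ∀ n ≥ N, 0 < n ∧ |laguerre n x| < 1 / (n : ℝ) ^ ((3 : ℝ) / 8) := by
    have h := hfin.eventually_cofinite_notMem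
    rw [Nat.cofinite_eq_atTop] at h
    refine Filter.eventually_atTop.1 ?_
    filter_upwards [h, Filter.eventually_gt_atTop 0] with n hn h0
    exact ⟨h0, not_le.1 fun h => hn ⟨h0, h⟩⟩
  have hupper : ∀ n ≥ N,
      laguerreKernel n x ≤ laguerreKernel N x + 4 * ((n : ℝ) - 1) ^ (1 / 4 : ℝ) := by
    intro n hn
    induction n, hn using Nat.le_induction with
    | base =>
      have h1 : (1 : ℝ) ≤ N := by exact_mod_cast (hN N le_rfl).1
      have := Real.rpow_nonneg (sub_nonneg.2 h1) (1 / 4)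
      linarith
    | succ n hn ih =>
      obtain ⟨h0, h1⟩ := hN n hn
      have hn0 : (0 : ℝ) < n := by exact_mod_cast h0
      have h2 : laguerre n x ^ 2 ≤ (n : ℝ) ^ (-(3 / 4) : ℝ) := by
        calc laguerre n x ^ 2 = |laguerre n x| ^ 2 := (sq_abs _).symm
          _ ≤ (1 / (n : ℝ) ^ ((3 : ℝ) / 8)) ^ 2 := by gcongr
          _ = _ := by
            rw [one_div, ← Real.rpow_neg hn0.le, ← Real.rpow_mul_natCast hn0.le]
            norm_num
      have h3 := rpow_neg_le_sub_rpow h0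
      rw [laguerreKernel_succ]
      push_cast
      rw [add_sub_cancel_right]
      linarith
  obtain ⟨c, hc, hlower⟩ := exists_rpow_le_laguerreKernel hx
  have ht := tendsto_natCast_atTop_atTop (R := ℝ)
  have ht1 := ((tendsto_rpow_atTop (show (0 : ℝ) < 1 / 8 by norm_num)).comp
    ht).eventually_gt_atTop ((laguerreKernel N x + 4) / c)
  obtain ⟨n, h1, h2, h3, h4⟩ := (hlower.and (ht1.and ((Filter.eventually_ge_atTop N).and
    (Filter.eventually_ge_atTop 1)))).exists
  have hn1 : (1 : ℝ) ≤ n := by exact_mod_cast h4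
  have h5 := hupper n h3
  have h6 : ((n : ℝ) - 1) ^ (1 / 4 : ℝ) ≤ (n : ℝ) ^ (1 / 4 : ℝ) := by
    gcongr
    all_goals linarith
  have h7 : (1 : ℝ) ≤ (n : ℝ) ^ (1 / 4 : ℝ) := Real.one_le_rpow hn1 (by norm_num)
  have h8 : (n : ℝ) ^ (3 / 8 : ℝ) = (n : ℝ) ^ (1 / 8 : ℝ) * (n : ℝ) ^ (1 / 4 : ℝ) := by
    rw [← Real.rpow_add (by linarith)]
    norm_num
  have h9 : 0 ≤ laguerreKernel N x := Finset.sum_nonneg fun _ _ => sq_nonneg _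
  rw [Function.comp_apply, div_lt_iff₀ hc] at h2
  rw [h8] at h1
  nlinarith
end

section
/- Let L_j denote the j-th Laguerre polynomial, L_j(x) = ∑_{k=0}^{j} (j choose k) · (−1)^k / k! · x^k. Then for every real x > 0 and every ε > 0 there exists a constant C > 0 such that L_j(x) ≥ C / j^{1/4 + ε} for infinitely many positive integers j. -/
open Filter Topology

/-- The Euler operator, `x` times the derivative, applied to the Laguerre polynomial. -/
noncomputable def laguerreEuler (j : ℕ) (x : ℝ) : ℝ :=
  ∑ k ∈ Finset.range (j + 1), (j.choose k : ℝ) * k * (-1) ^ k / (k.factorial : ℝ) * x ^ k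

lemma laguerreEuler_succ (j : ℕ) (x : ℝ) :
    laguerreEuler (j + 1) x = laguerreEuler j x - x * laguerre j x := by
  have h : laguerreEuler j x = ∑ k ∈ Finset.range (j + 2),
      (j.choose k : ℝ) * k * (-1) ^ k / (k.factorial : ℝ) * x ^ k := by
    rw [Finset.sum_range_succ _ (j + 1)]; simp [laguerreEuler]
  rw [h, laguerreEuler, laguerre, Finset.sum_range_succ', Finset.sum_range_succ' _ (j + 1),
    Finset.mul_sum]
  simp only [Nat.cast_zero, mul_zero, zero_mul, zero_div, add_zero]
  rw [← Finset.sum_sub_distrib]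
  refine Finset.sum_congr rfl fun k _ => ?_
  rw [Nat.choose_succ_succ, Nat.factorial_succ]
  have : (k.factorial : ℝ) ≠ 0 := by positivity
  push_cast
  field_simp
  ring

lemma laguerre_succ_sub (j : ℕ) (x : ℝ) :
    ((j : ℝ) + 1) * (laguerre (j + 1) x - laguerre j x) = laguerreEuler (j + 1) x := by
  have h : laguerre j x = ∑ k ∈ Finset.range (j + 2),
      (j.choose k : ℝ) * (-1) ^ k / (k.factorial : ℝ) * x ^ k := by
    rw [Finset.sum_range_succ _ (j + 1)]; simp [laguerre]
  rw [h, laguerreEuler, laguerre, ← Finset.sum_sub_distrib, Finset.mul_sum]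
  refine Finset.sum_congr rfl fun k _ => ?_
  rcases k with _ | k
  · simp
  · have h1 : ((j : ℝ) + 1) * (j.choose k : ℝ) = ((j + 1).choose (k + 1) : ℝ) * (k + 1) := by
      exact_mod_cast Nat.add_one_mul_choose_eq j k
    have h2 : ((j + 1).choose (k + 1) : ℝ) = j.choose k + j.choose (k + 1) := by
      exact_mod_cast Nat.choose_succ_succ j k
    have : ((k + 1).factorial : ℝ) ≠ 0 := by positivity
    field_simp
    push_cast
    linear_combination x ^ (k + 1) * h1 + x ^ (k + 1) * ((j : ℝ) + 1) * h2

lemma abs_mul_le_of_pos {x : ℝ} (hx : 0 < x) (a b : ℝ) :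
    |a * b| ≤ (1 + 1 / x) * (x * a ^ 2 + b ^ 2) := by
  have h : (1 + 1 / x) * (x * a ^ 2 + b ^ 2) = a ^ 2 + b ^ 2 + (x * a ^ 2 + b ^ 2 / x) := by
    field_simp; ring
  have : 0 ≤ x * a ^ 2 + b ^ 2 / x := by positivity
  rw [h, abs_le]
  constructor <;> nlinarith [sq_nonneg (a + b), sq_nonneg (a - b)]

/-- The quadratic form by which `oscillatorEnergy` changes in one step has coefficients of
order `1 / s ^ 2`. -/
lemma abs_energy_increment_le {x s r : ℝ} (hx : 0 < x) (hs : 1 ≤ s) (hr : 0 < r)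
    (h : r ^ 2 = s ^ 2 + 1) (a b : ℝ) :
    |(1 / (r + s) - 1 / (2 * r) + x / (2 * r ^ 3)) * (x * a ^ 2)
      + s / r ^ 2 * (s / (r + s) - 1 + s / (2 * r)) * b ^ 2
      + (x / r ^ 2 - x * s / (r ^ 2 * (r + s)) - x * s / r ^ 3 - 1 / (2 * r * (r + s))) * (a * b)|
      ≤ (x + 1 + (3 * x + 1) * (1 + 1 / x)) * ((x * a ^ 2 + b ^ 2) / s ^ 2) := by
  have hs0 : 0 < s := by linarith
  have hsr : s ≤ r := by nlinarith
  have hrs : r - s = 1 / (r + s) := by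
    field_simp; linear_combination h
  have hu1 : 1 / (r + s) ≤ 1 / s := by gcongr; linarith
  have hu2 : 1 / r ≤ 1 / s := by gcongr
  have hs1 : 1 / s ≤ 1 := by rw [div_le_one hs0]; exact hs
  set u := 1 / (r + s) with hu
  set v := 1 / r with hv
  set w := 1 / s with hw
  have hu0 : 0 < u := by positivity
  have hv0 : 0 < v := by positivity
  have hsu : s * u ≤ 1 := by rw [hu, mul_one_div, div_le_one (by positivity)]; linarith
  have hsv : s * v ≤ 1 := by rw [hv, mul_one_div, div_le_one (by positivity)]; linarith
  have hvv : v * v ≤ w * w := by gcongr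
  have huv : u * v ≤ w * w := by gcongr
  have huv' : u * u * v ≤ w * w := by
    calc u * u * v ≤ 1 * (u * v) := by rw [mul_assoc]; gcongr; linarith
      _ ≤ _ := by linarith
  have c1 : |1 / (r + s) - 1 / (2 * r) + x / (2 * r ^ 3)| ≤ (x + 1) * (w * w) := by
    have e : 1 / (r + s) - 1 / (2 * r) + x / (2 * r ^ 3)
        = u * u * v / 2 + x * (v * v * v) / 2 := by
      have : 1 / (r + s) - 1 / (2 * r) = (r - s) * u * v / 2 := by
        rw [hu, hv]; field_simp; ring
      rw [this, hrs, hv]; field_simp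
    have h3 : v * v * v ≤ w * w := by
      calc v * v * v ≤ v * v * 1 := by gcongr; linarith
        _ ≤ _ := by linarith
    have : x * (v * v * v) ≤ x * (w * w) := by gcongr
    have : 0 < u * u * v := by positivity
    have : 0 < x * (v * v * v) := by positivity
    rw [e, abs_of_pos (by positivity)]
    linarith
  have c2 : |s / r ^ 2 * (s / (r + s) - 1 + s / (2 * r))| ≤ w * w := by
    have e : s / r ^ 2 * (s / (r + s) - 1 + s / (2 * r))
        = -(s * v * (v * u * (u / 2 + v / 2))) := by
      have : s / (r + s) - 1 + s / (2 * r) = -((r - s) * (u / 2 + v / 2)) := by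
        rw [hu, hv]; field_simp; ring
      rw [this, hrs, hv]; field_simp
    rw [e, abs_neg, abs_of_pos (by positivity)]
    calc s * v * (v * u * (u / 2 + v / 2)) ≤ 1 * (v * u * 1) := by gcongr; linarith
      _ ≤ _ := by linarith
  have c3 : |x / r ^ 2 - x * s / (r ^ 2 * (r + s)) - x * s / r ^ 3 - 1 / (2 * r * (r + s))|
      ≤ (3 * x + 1) * (w * w) := by
    have e : x / r ^ 2 - x * s / (r ^ 2 * (r + s)) - x * s / r ^ 3 - 1 / (2 * r * (r + s))
        = x * (v * v) - x * (v * v) * (s * u) - x * (v * v) * (s * v) - u * v / 2 := by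
      rw [hu, hv]; field_simp
    have h0 : x * (v * v) ≤ x * (w * w) := by gcongr
    have p0 : 0 < x * (v * v) := by positivity
    have h1 : x * (v * v) * (s * u) ≤ x * (v * v) * 1 := by gcongr
    have h2 : x * (v * v) * (s * v) ≤ x * (v * v) * 1 := by gcongr
    have p1 : 0 < x * (v * v) * (s * u) := by positivity
    have p2 : 0 < x * (v * v) * (s * v) := by positivity
    have p3 : 0 < u * v := by positivity
    have p4 : 0 < w * w := by positivity
    rw [e, abs_le]
    constructor <;> nlinarith
  have hP : 0 ≤ x * a ^ 2 + b ^ 2 := by positivity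
  have hww : (x * a ^ 2 + b ^ 2) / s ^ 2 = w * w * (x * a ^ 2 + b ^ 2) := by
    rw [hw]; field_simp
  have b1 := mul_le_mul c1 ((abs_of_nonneg (by positivity : 0 ≤ x * a ^ 2)).le) (abs_nonneg _)
    (by positivity)
  have b2 := mul_le_mul c2 ((abs_of_nonneg (by positivity : 0 ≤ b ^ 2)).le) (abs_nonneg _)
    (by positivity)
  have b3 := mul_le_mul c3 (abs_mul_le_of_pos hx a b) (abs_nonneg _) (by positivity)
  rw [← abs_mul] at b1 b2 b3
  refine (abs_add_three _ _ _).trans ?_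
  rw [hww]
  have q0 : 0 ≤ w * w := by positivity
  have q1 : (x + 1) * (w * w) * (x * a ^ 2) + w * w * b ^ 2
      ≤ (x + 1) * (w * w) * (x * a ^ 2 + b ^ 2) := by
    have : 0 ≤ x * (w * w * b ^ 2) := by positivity
    nlinarith
  linarith

/-- A quantity almost conserved along `d (n+1) = d n - x * L n`,
`(n+1) * (L (n+1) - L n) = d (n+1)`. -/
noncomputable def oscillatorEnergy (x : ℝ) (L d : ℕ → ℝ) (n : ℕ) : ℝ :=
  √n * (x * L n ^ 2 + d n ^ 2 / n - x * L n * d n / n) + L n * d n / (2 * √n)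

section Oscillator

variable {x : ℝ} {L d : ℕ → ℝ}

lemma abs_oscillatorEnergy_succ_sub_le (hx : 0 < x) (hd : ∀ n, d (n + 1) = d n - x * L n)
    (hL : ∀ n : ℕ, ((n : ℝ) + 1) * (L (n + 1) - L n) = d (n + 1)) {n : ℕ} (hn : 1 ≤ n) :
    |oscillatorEnergy x L d (n + 1) - oscillatorEnergy x L d n|
      ≤ (x + 1 + (3 * x + 1) * (1 + 1 / x)) * ((x * L n ^ 2 + d n ^ 2 / n) / n) := by
  have hn1 : (1 : ℝ) ≤ n := by exact_mod_cast hn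
  set s := √(n : ℝ) with hs
  set r := √((n : ℝ) + 1) with hr
  have hs1 : 1 ≤ s := Real.one_le_sqrt.mpr hn1
  have hs0 : 0 < s := by linarith
  have hss : (n : ℝ) = s ^ 2 := (Real.sq_sqrt (by positivity)).symm
  have hrr : r ^ 2 = s ^ 2 + 1 := by rw [hr, Real.sq_sqrt (by positivity), hss]
  have hr0 : 0 < r := Real.sqrt_pos.mpr (by positivity)
  have key := abs_energy_increment_le hx hs1 hr0 hrr (L n) (d n / s)
  have hL' : L (n + 1) = L n + d (n + 1) / r ^ 2 := by
    have := hL n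
    rw [hss, ← hrr] at this
    field_simp
    linarith
  have e2 : (d n / s) ^ 2 = d n ^ 2 / n := by rw [div_pow, hss]
  have eq : oscillatorEnergy x L d (n + 1) - oscillatorEnergy x L d n
      = (1 / (r + s) - 1 / (2 * r) + x / (2 * r ^ 3)) * (x * L n ^ 2)
      + s / r ^ 2 * (s / (r + s) - 1 + s / (2 * r)) * (d n / s) ^ 2
      + (x / r ^ 2 - x * s / (r ^ 2 * (r + s)) - x * s / r ^ 3 - 1 / (2 * r * (r + s)))
        * (L n * (d n / s)) := by
    have hrs : 1 / (r + s) = r - s := by field_simp; linear_combination -hrr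
    have inv : x * L (n + 1) ^ 2 + d (n + 1) ^ 2 / r ^ 2 - x * L (n + 1) * d (n + 1) / r ^ 2
        = x * L n ^ 2 + d n ^ 2 / r ^ 2 - x * L n * d n / r ^ 2 := by
      rw [hL', hd]; field_simp; ring
    have cross : L (n + 1) * d (n + 1) = L n * d n + (d n - x * L n) ^ 2 / r ^ 2
        - x * L n ^ 2 := by
      rw [hL', hd]; field_simp; ring
    have c : ((n + 1 : ℕ) : ℝ) = r ^ 2 := by push_cast; rw [hss, hrr]
    unfold oscillatorEnergy
    rw [c, inv, cross, Real.sqrt_sq hr0.le, ← hs, hss]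
    have f1 : ∀ y : ℝ, y / (r + s) = y * (r - s) := fun y => by
      rw [← hrs, mul_one_div]
    have f2 : x * s / (r ^ 2 * (r + s)) = x * s * (r - s) / r ^ 2 := by
      rw [mul_comm (r ^ 2), ← div_div, f1]
    have f3 : 1 / (2 * r * (r + s)) = (r - s) / (2 * r) := by
      rw [mul_comm (2 * r), ← div_div, f1, one_mul]
    rw [f2, f3, f1, f1]
    field_simp
    linear_combination (2 * x * r * L n * d n - 2 * r * d n ^ 2) * hrr
  rw [eq, ← e2, hss]
  exact key

lemma abs_oscillatorEnergy_sub_le (hx : 0 < x) {n : ℕ} (hn : 1 ≤ n) :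
    |oscillatorEnergy x L d n - √n * (x * L n ^ 2 + d n ^ 2 / n)|
      ≤ |1 / 2 - x| * (1 + 1 / x) * (x * L n ^ 2 + d n ^ 2 / n) := by
  have hn1 : (1 : ℝ) ≤ n := by exact_mod_cast hn
  have hs0 : 0 < √(n : ℝ) := Real.sqrt_pos.mpr (by linarith)
  have hss : √(n : ℝ) ^ 2 = n := Real.sq_sqrt (by positivity)
  have e : oscillatorEnergy x L d n - √n * (x * L n ^ 2 + d n ^ 2 / n)
      = (1 / 2 - x) * (L n * (d n / √n)) := by
    unfold oscillatorEnergy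
    field_simp
    rw [hss]
    ring
  have e2 : d n ^ 2 / n = (d n / √n) ^ 2 := by rw [div_pow, hss]
  rw [e, e2, abs_mul, mul_assoc]
  gcongr
  exact abs_mul_le_of_pos hx _ _

lemma oscillator_ne_zero (hd : ∀ n, d (n + 1) = d n - x * L n)
    (hL : ∀ n : ℕ, ((n : ℝ) + 1) * (L (n + 1) - L n) = d (n + 1)) (h0 : L 0 ≠ 0) (n : ℕ) :
    L n ≠ 0 ∨ d n ≠ 0 := by
  induction n with
  | zero => exact .inl h0
  | succ n ih =>
    by_contra! h
    have h1 : L n = 0 := by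
      have := hL n
      rw [h.1, h.2] at this
      have hn : (n : ℝ) + 1 ≠ 0 := by positivity
      simpa [hn] using this
    have h2 := hd n
    rw [h.2, h1] at h2
    rcases ih with ih | ih
    · exact ih h1
    · exact ih (by linarith)

end Oscillator

lemma abs_log_sub_log_le {p q a : ℝ} (hp : 0 < p) (ha : a ≤ 1 / 2) (h : |q - p| ≤ a * p) :
    |Real.log q - Real.log p| ≤ 2 * a := by
  have ha0 : 0 ≤ a := nonneg_of_mul_nonneg_left ((abs_nonneg _).trans h) hp
  rw [abs_le] at h
  have hq : 0 < q := by nlinarith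
  have h1 := Real.log_le_sub_one_of_pos (div_pos hq hp)
  have h2 := Real.one_sub_inv_le_log_of_pos (div_pos hq hp)
  rw [Real.log_div hq.ne' hp.ne'] at h1 h2
  have h3 : q / p ≤ 1 + a := by rw [div_le_iff₀ hp]; linarith
  have h4 : (q / p)⁻¹ ≤ 1 + 2 * a := by
    rw [inv_div, div_le_iff₀ hq]
    nlinarith
  rw [abs_le]
  constructor <;> linarith

lemma exists_pos_tendsto_of_abs_sub_le {G a : ℕ → ℝ} (ha : Summable a)
    (hG : ∀ᶠ n in atTop, 0 < G n) (h : ∀ᶠ n in atTop, |G (n + 1) - G n| ≤ a n * G n) :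
    ∃ g > 0, Tendsto G atTop (𝓝 g) := by
  have ha2 : ∀ᶠ n in atTop, a n ≤ 1 / 2 :=
    (ha.tendsto_atTop_zero.eventually_lt_const (by norm_num)).mono fun _ h => h.le
  obtain ⟨N, hN⟩ := eventually_atTop.mp (hG.and (h.and ha2))
  have hc : CauchySeq fun n => Real.log (G (n + N)) := by
    refine cauchySeq_of_dist_le_of_summable (fun n => 2 * a (n + N)) (fun n => ?_)
      (((summable_nat_add_iff N).mpr ha).mul_left 2)
    obtain ⟨h1, h2, h3⟩ := hN (n + N) (by omega)
    rw [dist_comm, Real.dist_eq, Nat.succ_eq_add_one, add_right_comm]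
    exact abs_log_sub_log_le h1 h3 h2
  obtain ⟨l, hl⟩ := cauchySeq_tendsto_of_complete hc
  refine ⟨Real.exp l, Real.exp_pos l, (tendsto_add_atTop_iff_nat N).mp ?_⟩
  refine ((Real.continuous_exp.tendsto l).comp hl).congr fun n => ?_
  exact Real.exp_log (hN (n + N) (by omega)).1

section Oscillator

variable {x : ℝ} {L d : ℕ → ℝ}

lemma exists_amplitude_bounds (hx : 0 < x) (hd : ∀ n, d (n + 1) = d n - x * L n)
    (hL : ∀ n : ℕ, ((n : ℝ) + 1) * (L (n + 1) - L n) = d (n + 1)) (h0 : L 0 ≠ 0) :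
    ∃ g > 0, ∀ᶠ n : ℕ in atTop, g / 3 ≤ √n * (x * L n ^ 2 + d n ^ 2 / n) ∧
      √n * (x * L n ^ 2 + d n ^ 2 / n) ≤ 4 * g := by
  have hsqrt : Tendsto (fun n : ℕ => √(n : ℝ)) atTop atTop :=
    Real.tendsto_sqrt_atTop.comp tendsto_natCast_atTop_atTop
  set K := x + 1 + (3 * x + 1) * (1 + 1 / x) with hK
  have hK0 : 0 < K := by positivity
  have close : ∀ᶠ n : ℕ in atTop,
      √n * (x * L n ^ 2 + d n ^ 2 / n) ≤ 2 * oscillatorEnergy x L d n ∧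
      oscillatorEnergy x L d n ≤ 3 / 2 * (√n * (x * L n ^ 2 + d n ^ 2 / n)) := by
    filter_upwards [hsqrt.eventually_ge_atTop (2 * (|1 / 2 - x| * (1 + 1 / x))),
      eventually_ge_atTop 1] with n hn hn1
    have hP : 0 ≤ x * L n ^ 2 + d n ^ 2 / n := by positivity
    have h1 := abs_le.mp (abs_oscillatorEnergy_sub_le (L := L) (d := d) hx hn1)
    have h2 := mul_le_mul_of_nonneg_right hn hP
    constructor <;> linarith [h1.1, h1.2]
  have pos : ∀ᶠ n in atTop, 0 < oscillatorEnergy x L d n := by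
    filter_upwards [close, eventually_ge_atTop 1] with n hn hn1
    have hn0 : (0 : ℝ) < n := by exact_mod_cast hn1
    have : 0 < x * L n ^ 2 + d n ^ 2 / n := by
      rcases oscillator_ne_zero hd hL h0 n with h | h <;> positivity
    have : 0 < √n * (x * L n ^ 2 + d n ^ 2 / n) := by positivity
    linarith [hn.1]
  have hsum : Summable fun n : ℕ => 2 * K * (1 / (n : ℝ) ^ (3 / 2 : ℝ)) :=
    (Real.summable_one_div_nat_rpow.mpr (by norm_num)).mul_left _
  obtain ⟨g, hg, hlim⟩ := exists_pos_tendsto_of_abs_sub_le hsum pos (by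
    filter_upwards [close, eventually_ge_atTop 1] with n hn hn1
    have hn0 : (0 : ℝ) < n := by exact_mod_cast hn1
    have hs0 : 0 < √(n : ℝ) := Real.sqrt_pos.mpr hn0
    refine (abs_oscillatorEnergy_succ_sub_le hx hd hL hn1).trans ?_
    have e : (n : ℝ) ^ (3 / 2 : ℝ) = n * √n := by
      rw [Real.sqrt_eq_rpow, ← Real.rpow_one_add' hn0.le (by norm_num)]
      norm_num
    rw [e, ← hK]
    calc K * ((x * L n ^ 2 + d n ^ 2 / n) / n)
        = K * (1 / (n * √n)) * (√n * (x * L n ^ 2 + d n ^ 2 / n)) := by field_simp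
      _ ≤ K * (1 / (n * √n)) * (2 * oscillatorEnergy x L d n) :=
          mul_le_mul_of_nonneg_left hn.1 (by positivity)
      _ = _ := by ring)
  refine ⟨g, hg, ?_⟩
  filter_upwards [close, hlim.eventually_lt_const (by linarith : g < 2 * g),
    hlim.eventually_const_lt (by linarith : g / 2 < g)] with n hn h1 h2
  constructor <;> linarith [hn.1, hn.2]

lemma exists_large_value (hx : 0 < x) (hd : ∀ n, d (n + 1) = d n - x * L n)
    (hL : ∀ n : ℕ, ((n : ℝ) + 1) * (L (n + 1) - L n) = d (n + 1)) (h0 : L 0 ≠ 0) :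
    ∃ C > 0, ∀ᶠ M : ℕ in atTop, ∃ n ≥ M ^ 4, C / M ≤ L n := by
  obtain ⟨g, hg, hP⟩ := exists_amplitude_bounds hx hd hL h0
  obtain ⟨n₁, hP⟩ := eventually_atTop.mp hP
  set b := √(4 * g / x) with hb
  set e := √(8 * g) with he
  have hb0 : 0 < b := Real.sqrt_pos.mpr (by positivity)
  have he0 : 0 < e := Real.sqrt_pos.mpr (by positivity)
  have hbb : b ^ 2 = 4 * g / x := Real.sq_sqrt (by positivity)
  have hee : e ^ 2 = 8 * g := Real.sq_sqrt (by positivity)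
  set C := g / (48 * x * b) with hC
  have hC0 : 0 < C := by positivity
  refine ⟨C, hC0, ?_⟩
  filter_upwards [eventually_ge_atTop n₁, eventually_ge_atTop 1,
    (tendsto_natCast_atTop_atTop (R := ℝ)).eventually_gt_atTop (24 * (3 * (b * e) + 4 * g) / g)]
    with M hM1 hM hMlarge
  by_contra! hsmall
  have hM' : (1 : ℝ) ≤ M := by exact_mod_cast hM
  have hM0 : (0 : ℝ) < M := by linarith
  have hMpow : M ≤ M ^ 4 := Nat.le_self_pow (by norm_num) M
  have bounds : ∀ n : ℕ, M ^ 4 ≤ n → n ≤ 2 * M ^ 4 →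
      g / (6 * M ^ 2) ≤ x * L n ^ 2 + d n ^ 2 / n ∧ x * L n ^ 2 + d n ^ 2 / n ≤ 4 * g / M ^ 2 ∧
      |L n| ≤ b / M ∧ |d n| ≤ e * M := by
    intro n hn1 hn2
    obtain ⟨hlo, hhi⟩ := hP n (by omega)
    have hn1' : (M : ℝ) ^ 4 ≤ n := by exact_mod_cast hn1
    have hn2' : (n : ℝ) ≤ 2 * M ^ 4 := by exact_mod_cast hn2
    have hn0 : (0 : ℝ) < n := lt_of_lt_of_le (by positivity) hn1'
    have s1 : (M : ℝ) ^ 2 ≤ √n := Real.le_sqrt_of_sq_le (by nlinarith)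
    have s2 : √n ≤ 2 * (M : ℝ) ^ 2 := Real.sqrt_le_iff.mpr ⟨by positivity, by nlinarith⟩
    have hss : √(n : ℝ) ^ 2 = n := Real.sq_sqrt hn0.le
    have hs0 : 0 < √(n : ℝ) := Real.sqrt_pos.mpr hn0
    have hPP : 0 ≤ x * L n ^ 2 + d n ^ 2 / n := by positivity
    have hd2 : 0 ≤ d n ^ 2 / n := by positivity
    have hL2 : 0 ≤ x * L n ^ 2 := by positivity
    have up : x * L n ^ 2 + d n ^ 2 / n ≤ 4 * g / M ^ 2 := by
      rw [le_div_iff₀ (by positivity)]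
      nlinarith
    refine ⟨?_, up, ?_, ?_⟩
    · rw [div_le_iff₀ (by positivity)]
      nlinarith
    · refine abs_le_of_sq_le_sq ?_ (by positivity)
      rw [div_pow, hbb, div_right_comm, le_div_iff₀ hx]
      linarith
    · refine abs_le_of_sq_le_sq ?_ (by positivity)
      rw [mul_pow, hee]
      have : d n ^ 2 = √n * (√n * (d n ^ 2 / n)) := by
        rw [← mul_assoc, ← sq, hss]; field_simp
      rw [this]
      calc √n * (√n * (d n ^ 2 / n)) ≤ 2 * (M : ℝ) ^ 2 * (4 * g) := by
            refine mul_le_mul s2 (le_trans ?_ hhi) (by positivity) (by positivity)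
            gcongr
            linarith
        _ = _ := by ring
  let U : ℕ → ℝ := fun n => L n * d n - d n ^ 2 / n + 2 * b / M * d n
  have hU : ∀ n : ℕ, M ^ 4 ≤ n → n ≤ 2 * M ^ 4 → |U n| ≤ 3 * (b * e) + 4 * g := by
    intro n hn1 hn2
    obtain ⟨-, h1, h2, h3⟩ := bounds n hn1 hn2
    have t1 : |L n * d n| ≤ b * e := by
      rw [abs_mul]
      calc |L n| * |d n| ≤ b / M * (e * M) := by gcongr
        _ = b * e := by field_simp
    have t2 : |2 * b / M * d n| ≤ 2 * (b * e) := by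
      rw [abs_mul, abs_of_pos (by positivity : 0 < 2 * b / (M : ℝ))]
      calc 2 * b / M * |d n| ≤ 2 * b / M * (e * M) := by gcongr
        _ = 2 * (b * e) := by field_simp
    have t3 : 4 * g / (M : ℝ) ^ 2 ≤ 4 * g := div_le_self (by positivity) (by nlinarith)
    have t4 : 0 ≤ d n ^ 2 / n := by positivity
    have t5 : 0 ≤ x * L n ^ 2 := by positivity
    rw [abs_le] at t1 t2 ⊢
    constructor <;> simp only [U] <;> linarith
  have step : ∀ n : ℕ, M ^ 4 ≤ n → n ≤ 2 * M ^ 4 → g / (12 * M ^ 2) ≤ U (n + 1) - U n := by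
    intro n hn1 hn2
    obtain ⟨h1, -, h2, -⟩ := bounds n hn1 hn2
    have hLC := hsmall n hn1
    have hsq : L n ^ 2 ≤ b / M * (2 * (C / M) - L n) := by
      have hCM : 0 < C / (M : ℝ) := by positivity
      have hbM : 0 < b / (M : ℝ) := by positivity
      rw [abs_le] at h2
      rcases le_total 0 (L n) with h | h <;> nlinarith
    have hbC : 4 * x * (b / M * (C / M)) = g / (12 * M ^ 2) := by
      rw [hC]; field_simp; norm_num
    have hsplit : g / (6 * (M : ℝ) ^ 2) = 2 * (g / (12 * M ^ 2)) := by field_simp; norm_num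
    have hn0 : ((n : ℝ) + 1) ≠ 0 := by positivity
    have cross : L (n + 1) * d (n + 1) - d (n + 1) ^ 2 / (n + 1) = L n * d n - x * L n ^ 2 := by
      have : L (n + 1) = L n + d (n + 1) / (n + 1) := by
        have := hL n
        field_simp
        linarith
      rw [this, hd]
      field_simp
      ring
    have hdiff : U (n + 1) - U n = d n ^ 2 / n - x * L n ^ 2 - 2 * x * (b / M * L n) := by
      simp only [U]
      push_cast
      rw [cross, hd]
      ring
    have := mul_le_mul_of_nonneg_left hsq (by positivity : 0 ≤ 2 * x)
    rw [hdiff]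
    linarith
  have tele : ∀ k : ℕ, k ≤ M ^ 4 → k * (g / (12 * M ^ 2)) ≤ U (M ^ 4 + k) - U (M ^ 4) := by
    intro k
    induction k with
    | zero => simp
    | succ k ih =>
      intro hk
      have h1 := ih (by omega)
      have h2 := step (M ^ 4 + k) (by omega) (by omega)
      rw [← add_assoc]
      push_cast
      linarith
  have h1 := tele (M ^ 4) le_rfl
  have h2 := abs_le.mp (hU (M ^ 4) le_rfl (by omega))
  have h3 := abs_le.mp (hU (M ^ 4 + M ^ 4) (by omega) (by omega))
  have h4 : ((M ^ 4 : ℕ) : ℝ) * (g / (12 * M ^ 2)) = M ^ 2 * g / 12 := by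
    push_cast; field_simp
  rw [h4] at h1
  rw [div_lt_iff₀ hg] at hMlarge
  have h5 : (M : ℝ) * g ≤ M ^ 2 * g := by gcongr; nlinarith
  linarith [h2.1, h2.2, h3.1, h3.2]

end Oscillator

theorem laguerre_lower_bound (x : ℝ) (hx : 0 < x) (ε : ℝ) (hε : 0 < ε) :
    ∃ C > 0, {j : ℕ | 0 < j ∧ C / (j : ℝ) ^ (1 / 4 + ε) ≤ laguerre j x}.Infinite := by
  obtain ⟨C, hC, h⟩ := exists_large_value (L := fun n => laguerre n x)
    (d := fun n => laguerreEuler n x) hx (fun n => laguerreEuler_succ n x)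
    (fun n => laguerre_succ_sub n x) (by simp [laguerre])
  refine ⟨C, hC, Set.infinite_of_not_bddAbove ?_⟩
  rintro ⟨B, hB⟩
  obtain ⟨M, ⟨n, hn, hCn⟩, hM⟩ := (h.and (eventually_gt_atTop B)).exists
  have hMn : M ≤ n := (Nat.le_self_pow (by norm_num) M).trans hn
  have hM0 : (0 : ℝ) < M := by exact_mod_cast (by omega : 0 < M)
  have hn1 : (1 : ℝ) ≤ n := by exact_mod_cast (by omega : 1 ≤ n)
  have key : (M : ℝ) ≤ (n : ℝ) ^ (1 / 4 + ε) := by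
    calc (M : ℝ) = ((M : ℝ) ^ 4) ^ (1 / 4 : ℝ) := by
          rw [← Real.rpow_natCast, ← Real.rpow_mul hM0.le]; norm_num
      _ ≤ (n : ℝ) ^ (1 / 4 : ℝ) := by
          gcongr
          exact_mod_cast hn
      _ ≤ _ := Real.rpow_le_rpow_of_exponent_le hn1 (by linarith)
  have : n ≤ B := hB ⟨by omega, (div_le_div_of_nonneg_left hC.le hM0 key).trans hCn⟩
  omega
end

section
/- Let r, s : ℕ → ℝ be nonnegative sequences with ∑_i r i = 1 and ∑_j s j = 1, and let p : ℕ → ℕ → ℝ be nonnegative with ∑_j p i j ≤ 1 for every i and ∑_i p i j ≤ 1 for every j. Then for every α ∈ (0, 1), the family (i, j) ↦ (r i)^α · (s j)^{1−α} · p i j is summable and ∑_{i, j} (r i)^α · (s j)^{1−α} · p i j ≤ 1. -/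
/-- Summing a nonnegative sequence of total mass `c` against a substochastic kernel over a finite
rectangle gives at most `c`. -/
theorem sum_sum_mul_le_of_hasSum {ι κ : Type*} {f : ι → ℝ} {p : ι → κ → ℝ} {c : ℝ}
    (hf : ∀ i, 0 ≤ f i) (hfc : HasSum f c) (G : Finset κ)
    (hp : ∀ i, ∑ j ∈ G, p i j ≤ 1) (F : Finset ι) :
    ∑ i ∈ F, ∑ j ∈ G, f i * p i j ≤ c := by
  refine le_trans (Finset.sum_le_sum fun i _ => ?_) (sum_le_hasSum F (fun i _ => hf i) hfc)
  rw [← Finset.mul_sum]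
  exact mul_le_of_le_one_right (hf i) (hp i)


theorem petz_renyi_summable_le_one
    (r s : ℕ → ℝ) (hr : ∀ i, 0 ≤ r i) (hs : ∀ j, 0 ≤ s j)
    (hr1 : HasSum r 1) (hs1 : HasSum s 1)
    (p : ℕ → ℕ → ℝ) (hp : ∀ i j, 0 ≤ p i j)
    (hrow : ∀ i, ∀ F : Finset ℕ, ∑ j ∈ F, p i j ≤ 1)
    (hcol : ∀ j, ∀ F : Finset ℕ, ∑ i ∈ F, p i j ≤ 1)
    (α : ℝ) (hα0 : 0 < α) (hα1 : α < 1) :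
    Summable (fun ij : ℕ × ℕ => r ij.1 ^ α * s ij.2 ^ (1 - α) * p ij.1 ij.2) ∧
      ∑' ij : ℕ × ℕ, r ij.1 ^ α * s ij.2 ^ (1 - α) * p ij.1 ij.2 ≤ 1 := by
  have h_nonneg : ∀ ij : ℕ × ℕ, 0 ≤ r ij.1 ^ α * s ij.2 ^ (1 - α) * p ij.1 ij.2 := fun ij =>
    mul_nonneg (mul_nonneg (Real.rpow_nonneg (hr _) _) (Real.rpow_nonneg (hs _) _)) (hp _ _)
  have h_bound : ∀ u : Finset (ℕ × ℕ),
      ∑ ij ∈ u, r ij.1 ^ α * s ij.2 ^ (1 - α) * p ij.1 ij.2 ≤ 1 := by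
    intro u
    set F := u.image Prod.fst
    set G := u.image Prod.snd
    have h_row : ∑ i ∈ F, ∑ j ∈ G, r i * p i j ≤ 1 :=
      sum_sum_mul_le_of_hasSum hr hr1 G (fun i => hrow i G) F
    have h_col : ∑ i ∈ F, ∑ j ∈ G, s j * p i j ≤ 1 := by
      rw [Finset.sum_comm]
      exact sum_sum_mul_le_of_hasSum (p := fun j i => p i j) hs hs1 F (fun j => hcol j F) G
    calc ∑ ij ∈ u, r ij.1 ^ α * s ij.2 ^ (1 - α) * p ij.1 ij.2
        ≤ ∑ ij ∈ F ×ˢ G, r ij.1 ^ α * s ij.2 ^ (1 - α) * p ij.1 ij.2 :=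
          Finset.sum_le_sum_of_subset_of_nonneg Finset.subset_product fun ij _ _ => h_nonneg ij
      _ = ∑ i ∈ F, ∑ j ∈ G, r i ^ α * s j ^ (1 - α) * p i j := Finset.sum_product _ _ _
      _ ≤ ∑ i ∈ F, ∑ j ∈ G, (α * (r i * p i j) + (1 - α) * (s j * p i j)) := by
          refine Finset.sum_le_sum fun i _ => Finset.sum_le_sum fun j _ => ?_
          rw [← mul_assoc, ← mul_assoc, ← add_mul]
          exact mul_le_mul_of_nonneg_right (Real.geom_mean_le_arith_mean2_weighted hα0.le
            (sub_nonneg.2 hα1.le) (hr i) (hs j) (by ring)) (hp i j)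
      _ = α * ∑ i ∈ F, ∑ j ∈ G, r i * p i j + (1 - α) * ∑ i ∈ F, ∑ j ∈ G, s j * p i j := by
          simp only [Finset.sum_add_distrib, Finset.mul_sum]
      _ ≤ 1 := by
          linarith [mul_le_mul_of_nonneg_left h_row hα0.le,
            mul_le_mul_of_nonneg_left h_col (sub_nonneg.2 hα1.le)]
  exact ⟨summable_of_sum_le h_nonneg h_bound, Real.tsum_le_of_sum_le h_nonneg h_bound⟩
end
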